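/- Let n ≥ 2, let K be a field, let G = C_{2n}(1,n) be the circulant graph on 2n vertices with connection set {1,n}, and let S = K[V(G)]. Then sdepth(S/I(G)) = ⌈n/2⌉ if n ≡ 1 (mod 4), and sdepth(S/I(G)) = ⌈(n−1)/2⌉ if n ≡ 2 (mod 4). If n ≡ 0 or 3 (mod 4), then ⌈(n−1)/2⌉ ≤ sdepth(S/I(G)) ≤ ⌈n/2⌉ + 1. -/

import Mathlib

open MvPolynomial

/-- The edge ideal of a simple graph `G`, inside `K[x_v : v ∈ V]`. -/
noncomputable def edgeIdeal (K : Type*) [Field K] {V : Type*} (G : SimpleGraph V) :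
    Ideal (MvPolynomial V K) :=
  Ideal.span {m | ∃ i j : V, G.Adj i j ∧ m = X i * X j}

/-- The graded maximal ideal of `K[x_v : v ∈ V]`. -/
noncomputable def maxIdeal (K : Type*) [Field K] (V : Type*) : Ideal (MvPolynomial V K) :=
  Ideal.span (Set.range (X : V → MvPolynomial V K))

/-- depth of `S/I` over `S = K[x_v]`: the supremum of lengths of regular sequences on `S/I`
consisting of elements of the graded maximal ideal. -/
noncomputable def depthQuot {K : Type*} [Field K] {V : Type*} (I : Ideal (MvPolynomial V K)) : ℕ :=
  sSup {n : ℕ | ∃ rs : List (MvPolynomial V K), rs.length = n ∧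
    (∀ r ∈ rs, r ∈ maxIdeal K V) ∧
    RingTheory.Sequence.IsRegular (MvPolynomial V K ⧸ I) rs}

/-- The Stanley space `u·K[Z]` inside `S/I`, as a `K`-subspace. -/
noncomputable def stanleySpace {K : Type*} [Field K] {V : Type*}
    (I : Ideal (MvPolynomial V K)) (u : V →₀ ℕ) (Z : Finset V) :
    Submodule K (MvPolynomial V K ⧸ I) :=
  Submodule.span K
    {x | ∃ a : V →₀ ℕ, a.support ⊆ Z ∧ x = Ideal.Quotient.mk I (monomial (u + a) (1 : K))}

/-- A Stanley decomposition of `S/I`: a finite family of Stanley spaces `u_j K[Z_j]`,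
each of which is a free `K[Z_j]`-module (expressed by linear independence of the monomial
spanning set), whose internal direct sum is all of `S/I`. -/
structure StanleyDecomposition {K : Type*} [Field K] {V : Type*}
    (I : Ideal (MvPolynomial V K)) : Type _ where
  m : ℕ
  u : Fin m → (V →₀ ℕ)
  Z : Fin m → Finset V
  free : ∀ j : Fin m, LinearIndependent K
    (fun a : {a : V →₀ ℕ // a.support ⊆ Z j} =>
      Ideal.Quotient.mk I (monomial (u j + (a : V →₀ ℕ)) (1 : K)))
  internal : DirectSum.IsInternal (fun j : Fin m => stanleySpace I (u j) (Z j))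

/-- The Stanley depth of `S/I`. -/
noncomputable def sdepthQuot {K : Type*} [Field K] {V : Type*}
    (I : Ideal (MvPolynomial V K)) : ℕ :=
  sSup {n : ℕ | ∃ D : StanleyDecomposition I, ∀ j, n ≤ (D.Z j).card}

/-- `pdimLE R n M`: the `R`-module `M` has projective dimension at most `n`,
i.e. it admits a projective resolution of length `n`. -/
def pdimLE (R : Type*) [CommRing R] :
    (n : ℕ) → (M : Type*) → [AddCommGroup M] → [Module R M] → Prop
  | 0, M, _, _ => Module.Projective R M
  | (n+1), M, _, _ => ∃ (P : Type _) (_ : AddCommGroup P) (_ : Module R P)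
      (f : P →ₗ[R] M), Module.Projective R P ∧ Function.Surjective f ∧
        pdimLE R n (LinearMap.ker f)

/-- The projective dimension of `S/I` over `S`: the length of a minimal (projective/free)
resolution, i.e. the least `n` such that `S/I` has a projective resolution of length `n`. -/
noncomputable def pdimQuot {K : Type*} [Field K] {V : Type*}
    (I : Ideal (MvPolynomial V K)) : ℕ :=
  sInf {n : ℕ | pdimLE (MvPolynomial V K) n (MvPolynomial V K ⧸ I)}

/-- The ladder graph `A n` on `2n` vertices: `inl i = x_{i+1}`, `inr i = y_{i+1}`. -/
def graphA (n : ℕ) : SimpleGraph (Fin n ⊕ Fin n) :=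
  SimpleGraph.fromRel (fun a b =>
    match a, b with
    | .inl i, .inl j => (i : ℕ) + 1 = j
    | .inr i, .inr j => (i : ℕ) + 1 = j
    | .inl i, .inr j => (i : ℕ) = (j : ℕ)
    | .inr _, .inl _ => False)

/-- The graph `B n`: the ladder `A n` with one extra vertex `y_{n+1}` and edge `{y_n, y_{n+1}}`.
Here `inl i = x_{i+1}` (`i < n`) and `inr i = y_{i+1}` (`i < n+1`). -/
def graphB (n : ℕ) : SimpleGraph (Fin n ⊕ Fin (n+1)) :=
  SimpleGraph.fromRel (fun a b =>
    match a, b with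
    | .inl i, .inl j => (i : ℕ) + 1 = j
    | .inr i, .inr j => (i : ℕ) + 1 = j
    | .inl i, .inr j => (i : ℕ) = (j : ℕ)
    | .inr _, .inl _ => False)

/-- The graph `C n`: the ladder `A n` with two extra vertices `y_{n+1}, y_{n+2}` and extra
edges `{y_n, y_{n+1}}` and `{y_1, y_{n+2}}`. Here `inl i = x_{i+1}` (`i < n`) and
`inr i = y_{i+1}` (`i < n+2`). -/
def graphC (n : ℕ) : SimpleGraph (Fin n ⊕ Fin (n+2)) :=
  SimpleGraph.fromRel (fun a b =>
    match a, b with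
    | .inl i, .inl j => (i : ℕ) + 1 = j
    | .inr i, .inr j => ((i : ℕ) + 1 = j ∧ (j : ℕ) ≤ n) ∨ ((i : ℕ) = 0 ∧ (j : ℕ) = n + 1)
    | .inl i, .inr j => (i : ℕ) = (j : ℕ)
    | .inr _, .inl _ => False)

/-- The graph `D n`: the ladder `A n` with two extra vertices `x_{n+1}, y_{n+1}` and extra
edges `{y_n, y_{n+1}}` and `{x_1, x_{n+1}}`. Here `inl i = x_{i+1}` and `inr i = y_{i+1}`
(`i < n+1`). -/
def graphD (n : ℕ) : SimpleGraph (Fin (n+1) ⊕ Fin (n+1)) :=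
  SimpleGraph.fromRel (fun a b =>
    match a, b with
    | .inl i, .inl j => ((i : ℕ) + 1 = j ∧ (j : ℕ) ≤ n - 1) ∨ ((i : ℕ) = 0 ∧ (j : ℕ) = n)
    | .inr i, .inr j => (i : ℕ) + 1 = j
    | .inl i, .inr j => (i : ℕ) = (j : ℕ) ∧ (i : ℕ) ≤ n - 1
    | .inr _, .inl _ => False)

/-- The circulant graph `C_q(s)` on vertex set `{x_1, …, x_q}` (realized as `Fin q`):
`x_i` and `x_j` are adjacent iff `|i - j| ∈ s` or `q - |i - j| ∈ s`. -/
def circulantGraph (q : ℕ) (s : Set ℕ) : SimpleGraph (Fin q) :=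
  SimpleGraph.fromRel (fun i j =>
    ((i : ℤ) - (j : ℤ)).natAbs ∈ s ∨ q - ((i : ℤ) - (j : ℤ)).natAbs ∈ s)


/-! ### Combinatorial certificates -/

/-- Recursive certificate that the independent sets inside `W` can be partitioned into intervals
whose tops have at least `d` elements. -/
inductive Good {V : Type*} [DecidableEq V] (G : SimpleGraph V) : Finset V → ℕ → Prop
  | zero (W : Finset V) : Good G W 0
  | split (W W₁ W₂ : Finset V) (d : ℕ) (v : V) (hv : v ∈ W)
      (h₁ : ∀ w, w ∈ W₁ ↔ w ∈ W ∧ w ≠ v)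
      (h₂ : ∀ w, w ∈ W₂ ↔ w ∈ W ∧ w ≠ v ∧ ¬ G.Adj v w) :
      Good G W₁ (d + 1) → Good G W₂ d → Good G W (d + 1)
  | isol (W W₁ : Finset V) (d : ℕ) (v : V) (hv : v ∈ W)
      (h₁ : ∀ w, w ∈ W₁ ↔ w ∈ W ∧ w ≠ v)
      (h₂ : ∀ w ∈ W, ¬ G.Adj v w) :
      Good G W₁ d → Good G W (d + 1)

theorem Good.mono {V : Type*} [DecidableEq V] {G : SimpleGraph V} {W : Finset V} {d : ℕ}
    (h : Good G W d) : ∀ e, e ≤ d → Good G W e := by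
  induction h with
  | zero W => intro e he; obtain rfl : e = 0 := by omega
              exact .zero W
  | split W W₁ W₂ d v hv h₁ h₂ _ _ ih₁ ih₂ =>
    intro e he
    cases e with
    | zero => exact .zero W
    | succ e => exact .split W W₁ W₂ e v hv h₁ h₂ (ih₁ _ he) (ih₂ _ (by omega))
  | isol W W₁ d v hv h₁ h₂ _ ih =>
    intro e he
    cases e with
    | zero => exact .zero W
    | succ e => exact .isol W W₁ e v hv h₁ h₂ (ih _ (by omega))

theorem Good.transfer {U V : Type*} [DecidableEq U] [DecidableEq V] {L : SimpleGraph U}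
    {G : SimpleGraph V} {W : Finset U} {d : ℕ} (h : Good L W d) (φ : U → V) :
    (∀ a ∈ W, ∀ b ∈ W, φ a = φ b → a = b) →
    (∀ a ∈ W, ∀ b ∈ W, (G.Adj (φ a) (φ b) ↔ L.Adj a b)) →
    Good G (W.image φ) d := by
  induction h with
  | zero W => intro _ _; exact .zero _
  | split W W₁ W₂ d v hv h₁ h₂ _ _ ih₁ ih₂ =>
    intro hi ha
    have s₁ : ∀ w ∈ W₁, w ∈ W := fun w hw => ((h₁ w).1 hw).1
    have s₂ : ∀ w ∈ W₂, w ∈ W := fun w hw => ((h₂ w).1 hw).1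
    refine .split _ (W₁.image φ) (W₂.image φ) d (φ v) (Finset.mem_image_of_mem _ hv) ?_ ?_
      (ih₁ (fun a h b h' => hi a (s₁ a h) b (s₁ b h')) (fun a h b h' => ha a (s₁ a h) b (s₁ b h')))
      (ih₂ (fun a h b h' => hi a (s₂ a h) b (s₂ b h')) (fun a h b h' => ha a (s₂ a h) b (s₂ b h')))
    · intro w
      simp only [Finset.mem_image]
      constructor
      · rintro ⟨a, haW, rfl⟩
        exact ⟨⟨a, s₁ a haW, rfl⟩, fun e => ((h₁ a).1 haW).2 (hi _ (s₁ a haW) _ hv e)⟩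
      · rintro ⟨⟨a, haW, rfl⟩, hne⟩
        exact ⟨a, (h₁ a).2 ⟨haW, fun e => hne (e ▸ rfl)⟩, rfl⟩
    · intro w
      simp only [Finset.mem_image]
      constructor
      · rintro ⟨a, haW, rfl⟩
        exact ⟨⟨a, s₂ a haW, rfl⟩, fun e => ((h₂ a).1 haW).2.1 (hi _ (s₂ a haW) _ hv e),
          fun e => ((h₂ a).1 haW).2.2 ((ha _ hv _ (s₂ a haW)).1 e)⟩
      · rintro ⟨⟨a, haW, rfl⟩, hne, hadj⟩
        exact ⟨a, (h₂ a).2 ⟨haW, fun e => hne (e ▸ rfl),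
          fun e => hadj ((ha _ hv _ haW).2 e)⟩, rfl⟩
  | isol W W₁ d v hv h₁ h₂ _ ih =>
    intro hi ha
    have s₁ : ∀ w ∈ W₁, w ∈ W := fun w hw => ((h₁ w).1 hw).1
    refine .isol _ (W₁.image φ) d (φ v) (Finset.mem_image_of_mem _ hv) ?_ ?_
      (ih (fun a h b h' => hi a (s₁ a h) b (s₁ b h')) (fun a h b h' => ha a (s₁ a h) b (s₁ b h')))
    · intro w
      simp only [Finset.mem_image]
      constructor
      · rintro ⟨a, haW, rfl⟩
        exact ⟨⟨a, s₁ a haW, rfl⟩, fun e => ((h₁ a).1 haW).2 (hi _ (s₁ a haW) _ hv e)⟩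
      · rintro ⟨⟨a, haW, rfl⟩, hne⟩
        exact ⟨a, (h₁ a).2 ⟨haW, fun e => hne (e ▸ rfl)⟩, rfl⟩
    · intro w hw
      obtain ⟨a, haW, rfl⟩ := Finset.mem_image.1 hw
      exact fun e => h₂ a haW ((ha _ hv _ haW).1 e)

/-- independence of a finite vertex set -/
def Indep {V : Type*} (G : SimpleGraph V) (s : Finset V) : Prop :=
  ∀ a ∈ s, ∀ b ∈ s, ¬ G.Adj a b

theorem Indep.subset {V : Type*} {G : SimpleGraph V} {s t : Finset V} (h : Indep G t)
    (hs : s ⊆ t) : Indep G s := fun a ha b hb => h a (hs ha) b (hs hb)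

/-- An interval partition of the independent sets inside `W`. -/
def HasPart {V : Type*} (G : SimpleGraph V) (W : Finset V) (d : ℕ) : Prop :=
  ∃ (ι : Type) (_ : Finite ι) (A B : ι → Finset V),
    (∀ i, A i ⊆ B i ∧ B i ⊆ W ∧ Indep G (B i) ∧ d ≤ (B i).card) ∧
    (∀ s : Finset V, s ⊆ W → Indep G s → ∃ i, A i ⊆ s ∧ s ⊆ B i) ∧
    (∀ (s : Finset V) i j, A i ⊆ s → s ⊆ B i → A j ⊆ s → s ⊆ B j → i = j)

theorem Good.hasPart {V : Type} [DecidableEq V] {G : SimpleGraph V} {W : Finset V} {d : ℕ}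
    (h : Good G W d) : HasPart G W d := by
  induction h with
  | zero W =>
    refine ⟨{s : Finset V // s ∈ W.powerset ∧ Indep G s},
      Finite.of_injective (fun x => (⟨x.1, x.2.1⟩ : {s // s ∈ W.powerset}))
        (fun a b h => Subtype.ext (by simpa using h)), fun s => s.1, fun s => s.1, ?_, ?_, ?_⟩
    · rintro ⟨s, hs, hi⟩
      exact ⟨subset_rfl, Finset.mem_powerset.1 hs, hi, Nat.zero_le _⟩
    · intro s hs hi
      exact ⟨⟨s, Finset.mem_powerset.2 hs, hi⟩, subset_rfl, subset_rfl⟩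
    · rintro s ⟨i, _⟩ ⟨j, _⟩ h1 h2 h3 h4
      exact Subtype.ext ((h1.antisymm h2).trans (h3.antisymm h4).symm)
  | split W W₁ W₂ d v hv h₁ h₂ _ _ ih₁ ih₂ =>
    obtain ⟨ι, _, A, B, p1, p2, p3⟩ := ih₁
    obtain ⟨κ, _, C, D, q1, q2, q3⟩ := ih₂
    have hB : ∀ i, v ∉ B i := fun i hi => ((h₁ v).1 ((p1 i).2.1 hi)).2 rfl
    have hD : ∀ i, v ∉ D i := fun i hi => ((h₂ v).1 ((q1 i).2.1 hi)).2.1 rfl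
    refine ⟨ι ⊕ κ, inferInstance, Sum.elim A (fun k => insert v (C k)),
      Sum.elim B (fun k => insert v (D k)), ?_, ?_, ?_⟩
    · rintro (i | k)
      · exact ⟨(p1 i).1, fun x hx => ((h₁ x).1 ((p1 i).2.1 hx)).1, (p1 i).2.2⟩
      · refine ⟨Finset.insert_subset_insert _ (q1 k).1, ?_, ?_, ?_⟩
        · intro x hx
          rcases Finset.mem_insert.1 hx with rfl | hx
          · exact hv
          · exact ((h₂ x).1 ((q1 k).2.1 hx)).1
        · intro a ha b hb hab
          rcases Finset.mem_insert.1 ha with ha' | ha' <;>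
          rcases Finset.mem_insert.1 hb with hb' | hb'
          · subst ha'; subst hb'; exact G.loopless.irrefl _ hab
          · subst ha'; exact ((h₂ b).1 ((q1 k).2.1 hb')).2.2 hab
          · subst hb'; exact ((h₂ a).1 ((q1 k).2.1 ha')).2.2 hab.symm
          · exact (q1 k).2.2.1 a ha' b hb' hab
        · simp only [Sum.elim_inr]
          rw [Finset.card_insert_of_notMem (hD k)]
          exact Nat.succ_le_succ (q1 k).2.2.2
    · intro s hs hi
      by_cases hvs : v ∈ s
      · obtain ⟨k, hk1, hk2⟩ := q2 (s.erase v) (fun x hx => (h₂ x).2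
          ⟨hs (Finset.mem_of_mem_erase hx), Finset.ne_of_mem_erase hx,
            hi v hvs x (Finset.mem_of_mem_erase hx)⟩) (hi.subset (Finset.erase_subset _ _))
        refine ⟨Sum.inr k, ?_, ?_⟩
        · exact Finset.insert_subset hvs (hk1.trans (Finset.erase_subset _ _))
        · exact Finset.subset_insert_iff.2 hk2
      · obtain ⟨i, hi1, hi2⟩ := p2 s (fun x hx => (h₁ x).2
          ⟨hs hx, fun e => hvs (e ▸ hx)⟩) hi
        exact ⟨Sum.inl i, hi1, hi2⟩
    · have key : ∀ (s : Finset V) k, insert v (C k) ⊆ s → s ⊆ insert v (D k) →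
          v ∈ s ∧ C k ⊆ s.erase v ∧ s.erase v ⊆ D k := by
        intro s k h1 h2
        refine ⟨h1 (Finset.mem_insert_self _ _), ?_, Finset.subset_insert_iff.1 h2⟩
        intro x hx
        exact Finset.mem_erase.2 ⟨fun e => hD k (e ▸ (q1 k).1 hx),
          h1 (Finset.mem_insert_of_mem hx)⟩
      rintro s (i | i) (j | j) h1 h2 h3 h4
      · exact congrArg _ (p3 s i j h1 h2 h3 h4)
      · exact absurd (h2 (key s j h3 h4).1) (hB i)
      · exact absurd (h4 (key s i h1 h2).1) (hB j)
      · obtain ⟨_, a1, a2⟩ := key s i h1 h2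
        obtain ⟨_, b1, b2⟩ := key s j h3 h4
        exact congrArg _ (q3 _ i j a1 a2 b1 b2)
  | isol W W₁ d v hv h₁ h₂ _ ih =>
    obtain ⟨ι, _, A, B, p1, p2, p3⟩ := ih
    have hB : ∀ i, v ∉ B i := fun i hi => ((h₁ v).1 ((p1 i).2.1 hi)).2 rfl
    refine ⟨ι, inferInstance, A, fun i => insert v (B i), ?_, ?_, ?_⟩
    · intro i
      refine ⟨(p1 i).1.trans (Finset.subset_insert _ _), ?_, ?_, ?_⟩
      · intro x hx
        rcases Finset.mem_insert.1 hx with rfl | hx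
        · exact hv
        · exact ((h₁ x).1 ((p1 i).2.1 hx)).1
      · intro a ha b hb hab
        rcases Finset.mem_insert.1 ha with ha' | ha' <;>
        rcases Finset.mem_insert.1 hb with hb' | hb'
        · subst ha'; subst hb'; exact G.loopless.irrefl _ hab
        · subst ha'; exact h₂ b ((h₁ b).1 ((p1 i).2.1 hb')).1 hab
        · subst hb'; exact h₂ a ((h₁ a).1 ((p1 i).2.1 ha')).1 hab.symm
        · exact (p1 i).2.2.1 a ha' b hb' hab
      · rw [Finset.card_insert_of_notMem (hB i)]
        exact Nat.succ_le_succ (p1 i).2.2.2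
    · intro s hs hi
      obtain ⟨i, hi1, hi2⟩ := p2 (s.erase v) (fun x hx => (h₁ x).2
          ⟨hs (Finset.mem_of_mem_erase hx), Finset.ne_of_mem_erase hx⟩)
          (hi.subset (Finset.erase_subset _ _))
      exact ⟨i, hi1.trans (Finset.erase_subset _ _), Finset.subset_insert_iff.2 hi2⟩
    · intro s i j a1 a2 b1 b2
      have key : ∀ i, A i ⊆ s → A i ⊆ s.erase v := fun i h x hx =>
        Finset.mem_erase.2 ⟨fun e => hB i (e ▸ (p1 i).1 hx), h hx⟩
      exact p3 (s.erase v) i j (key i a1) (Finset.subset_insert_iff.1 a2) (key j b1)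
        (Finset.subset_insert_iff.1 b2)

/-! ### Ladders -/

/-- The infinite ladder. -/
def ladder : SimpleGraph (ℕ × Bool) where
  Adj a b := (a.1 = b.1 ∧ a.2 ≠ b.2) ∨ (a.2 = b.2 ∧ (a.1 + 1 = b.1 ∨ b.1 + 1 = a.1))
  symm := ⟨by
    rintro a b (⟨h, h'⟩ | ⟨h, h'⟩)
    · exact Or.inl ⟨h.symm, h'.symm⟩
    · exact Or.inr ⟨h.symm, h'.symm⟩⟩
  loopless := ⟨by
    rintro a (⟨_, h⟩ | ⟨_, h⟩)
    · exact h rfl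
    · omega⟩

/-- Columns `1..m`, plus `(0,s)`, plus `(m+1,r)`. -/
def lad (m : ℕ) (s : Finset Bool) (r : Bool) : Finset (ℕ × Bool) :=
  (Finset.range (m + 2) ×ˢ Finset.univ).filter
    (fun a => (a.1 = 0 ∧ a.2 ∈ s) ∨ (1 ≤ a.1 ∧ a.1 ≤ m) ∨ (a.1 = m + 1 ∧ a.2 = r))

theorem mem_lad {m : ℕ} {s : Finset Bool} {r : Bool} {c : ℕ} {t : Bool} :
    (c, t) ∈ lad m s r ↔ (c = 0 ∧ t ∈ s) ∨ (1 ≤ c ∧ c ≤ m) ∨ (c = m + 1 ∧ t = r) := by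
  simp only [lad, Finset.mem_filter, Finset.mem_product, Finset.mem_range, Finset.mem_univ,
    and_true]
  constructor
  · exact fun h => h.2
  · intro h
    refine ⟨?_, h⟩
    rcases h with h | h | h <;> omega

theorem lad_zero_empty (r : Bool) : Good ladder (lad 0 ∅ r) 1 := by
  refine .isol _ ∅ 0 (1, r) (mem_lad.2 (by simp)) ?_ ?_ (.zero _)
  · rintro ⟨c, t⟩
    rw [mem_lad]; simp; grind
  · rintro ⟨c, t⟩ h
    rw [mem_lad] at h; simp [ladder]; grind

theorem lad_zero_same (r : Bool) : Good ladder (lad 0 {r} r) 1 := by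
  refine .split _ {(0, r)} ∅ 0 (1, r) (mem_lad.2 (by simp)) ?_ ?_ ?_ (.zero _)
  · rintro ⟨c, t⟩
    rw [mem_lad]; simp; grind
  · rintro ⟨c, t⟩
    rw [mem_lad]; simp [ladder]; grind
  · refine .isol _ ∅ 0 (0, r) (by simp) ?_ ?_ (.zero _)
    · rintro ⟨c, t⟩; cases r <;> cases t <;> simp
    · rintro ⟨c, t⟩; cases r <;> cases t <;> simp [ladder] <;> omega

theorem lad_zero_diff (r : Bool) : Good ladder (lad 0 {!r} r) 2 := by
  refine .isol _ {(0, !r)} 1 (1, r) (mem_lad.2 (by simp)) ?_ ?_ ?_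
  · rintro ⟨c, t⟩
    rw [mem_lad]; simp; grind
  · rintro ⟨c, t⟩ h
    rw [mem_lad] at h; simp [ladder] at *; grind
  · refine .isol _ ∅ 0 (0, !r) (by simp) ?_ ?_ (.zero _)
    · rintro ⟨c, t⟩; cases r <;> cases t <;> simp
    · rintro ⟨c, t⟩; cases r <;> cases t <;> simp [ladder] <;> omega

/-- The recursion step, with the deletion case resolved. -/
theorem lad_step (m : ℕ) (s : Finset Bool) (r : Bool) (d : ℕ) (W₂ : Finset (ℕ × Bool))
    (h : Good ladder (lad m s (!r)) d)
    (h₂ : ∀ w, w ∈ W₂ ↔ w ∈ lad (m + 1) s r ∧ w ≠ (m + 1, r) ∧ ¬ ladder.Adj (m + 1, r) w)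
    (hW₂ : Good ladder W₂ d) : Good ladder (lad (m + 1) s r) (d + 1) := by
  refine .split _ ((lad (m + 1) s r).erase (m + 1, r)) W₂ d (m + 1, r)
    (mem_lad.2 (by simp)) (by simp [and_comm]) h₂ ?_ hW₂
  refine .isol _ (lad m s (!r)) d (m + 2, r) ?_ ?_ ?_ h
  · rw [Finset.mem_erase, mem_lad]; simp
  · rintro ⟨c, t⟩
    rw [Finset.mem_erase, mem_lad, mem_lad]; cases r <;> cases t <;> simp <;> grind
  · rintro ⟨c, t⟩ h
    rw [Finset.mem_erase, mem_lad] at h; simp [ladder] at *; grind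

theorem lad_step_two (m : ℕ) (s : Finset Bool) (r : Bool) (d : ℕ)
    (h : Good ladder (lad (m + 1) s (!r)) d) (h' : Good ladder (lad m s (!r)) d) :
    Good ladder (lad (m + 2) s r) (d + 1) := by
  refine lad_step (m + 1) s r d (lad m s (!r)) h ?_ h'
  rintro ⟨c, t⟩
  rw [mem_lad, mem_lad]; cases r <;> cases t <;> simp [ladder] <;> grind

theorem lad_all (m : ℕ) : ∀ r : Bool, Good ladder (lad m ∅ r) (m / 2 + 1) ∧
    Good ladder (lad m {r} r) (2 * ((m + 2) / 4) + 1) ∧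
    Good ladder (lad m {!r} r) (2 * (m / 4) + 2) := by
  induction m using Nat.strong_induction_on with
  | _ m ih =>
    intro r
    match m, ih with
    | 0, _ => exact ⟨lad_zero_empty r, lad_zero_same r, lad_zero_diff r⟩
    | 1, _ =>
      refine ⟨?_, ?_, ?_⟩
      · exact lad_step 0 ∅ r 0 ((lad 1 ∅ r).filter
          (fun w => w ≠ (1, r) ∧ ¬ ((1 = w.1 ∧ r ≠ w.2) ∨ (r = w.2 ∧ (1 + 1 = w.1 ∨ w.1 + 1 = 1)))))
          (.zero _) (fun w => Finset.mem_filter) (.zero _)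
      · exact lad_step 0 {r} r 0 ((lad 1 {r} r).filter
          (fun w => w ≠ (1, r) ∧ ¬ ((1 = w.1 ∧ r ≠ w.2) ∨ (r = w.2 ∧ (1 + 1 = w.1 ∨ w.1 + 1 = 1)))))
          (.zero _) (fun w => Finset.mem_filter) (.zero _)
      · refine lad_step 0 {!r} r 1 {(0, !r)} ?_ ?_ ?_
        · exact lad_zero_same _
        · rintro ⟨c, t⟩
          rw [mem_lad]; simp [ladder]; grind
        · refine .isol _ ∅ 0 (0, !r) (by simp) ?_ ?_ (.zero _)
          · rintro ⟨c, t⟩; cases r <;> cases t <;> simp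
          · rintro ⟨c, t⟩; cases r <;> cases t <;> simp [ladder] <;> omega
    | m + 2, ih =>
      have i1 := ih (m + 1) (by omega) (!r)
      have i0 := ih m (by omega) (!r)
      rw [Bool.not_not] at i1 i0
      refine ⟨?_, ?_, ?_⟩
      · exact (lad_step_two m ∅ r (m / 2 + 1) (i1.1.mono _ (by omega)) i0.1).mono _ (by omega)
      · exact (lad_step_two m {r} r (2 * (m / 4) + 2) (i1.2.2.mono _ (by omega)) i0.2.2).mono _
          (by omega)
      · exact (lad_step_two m {!r} r (2 * ((m + 2) / 4) + 1) (i1.2.1.mono _ (by omega))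
          i0.2.1).mono _ (by omega)

/-! ### Algebra of the monomial basis -/

theorem mem_edgeIdeal_iff {K : Type*} [Field K] {V : Type*} (G : SimpleGraph V)
    (p : MvPolynomial V K) :
    p ∈ edgeIdeal K G ↔ ∀ e ∈ p.support, ¬ Indep G e.support := by
  classical
  have hset : {m : MvPolynomial V K | ∃ i j : V, G.Adj i j ∧ m = X i * X j} =
      (fun s => monomial s (1 : K)) ''
        {s | ∃ i j : V, G.Adj i j ∧ s = Finsupp.single i 1 + Finsupp.single j 1} := by
    ext m
    simp only [Set.mem_ofPred_eq, Set.mem_image]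
    constructor
    · rintro ⟨i, j, h, rfl⟩
      exact ⟨_, ⟨i, j, h, rfl⟩, by simp [X, monomial_mul]⟩
    · rintro ⟨_, ⟨i, j, h, rfl⟩, rfl⟩
      exact ⟨i, j, h, by simp [X, monomial_mul]⟩
  rw [edgeIdeal, hset, mem_ideal_span_monomial_image]
  refine forall₂_congr fun e _ => ?_
  constructor
  · rintro ⟨_, ⟨i, j, h, rfl⟩, hle⟩ hind
    have hi := hle i
    have hj := hle j
    simp only [Finsupp.add_apply, Finsupp.single_eq_same] at hi hj
    exact hind i (Finsupp.mem_support_iff.2 (by omega)) j (Finsupp.mem_support_iff.2 (by omega)) h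
  · intro h
    simp only [Indep, not_forall, not_not] at h
    obtain ⟨i, hi, j, hj, hij⟩ := h
    refine ⟨_, ⟨i, j, hij, rfl⟩, ?_⟩
    intro x
    rw [Finsupp.mem_support_iff] at hi hj
    have hne : i ≠ j := hij.ne
    simp only [Finsupp.add_apply, Finsupp.single_apply]
    split_ifs with h1 h2 h2
    · exact absurd (h1.trans h2.symm) hne
    · subst h1; omega
    · subst h2; omega
    · omega

/-- Class of a monomial. -/
noncomputable def mcl (K : Type*) [Field K] {V : Type*} (G : SimpleGraph V) (e : V →₀ ℕ) :
    MvPolynomial V K ⧸ edgeIdeal K G := Ideal.Quotient.mk _ (monomial e (1 : K))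

theorem mcl_eq_zero_iff (K : Type*) [Field K] {V : Type*} (G : SimpleGraph V) (e : V →₀ ℕ) :
    mcl K G e = 0 ↔ ¬ Indep G e.support := by
  classical
  rw [mcl, Ideal.Quotient.eq_zero_iff_mem, mem_edgeIdeal_iff, support_monomial, if_neg one_ne_zero]
  simp

theorem mcl_linearIndependent (K : Type*) [Field K] {V : Type*} (G : SimpleGraph V) :
    LinearIndependent K (fun e : {e : V →₀ ℕ // Indep G e.support} => mcl K G e.1) := by
  have h0 := (basisMonomials V K).linearIndependent.comp
    (Subtype.val : {e : V →₀ ℕ // Indep G e.support} → (V →₀ ℕ)) Subtype.val_injective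
  refine h0.map (f := (Ideal.Quotient.mkₐ K (edgeIdeal K G)).toLinearMap) ?_
  rw [Submodule.disjoint_def]
  intro p hp hk
  have hk' : p ∈ edgeIdeal K G := Ideal.Quotient.eq_zero_iff_mem.1 hk
  rw [mem_edgeIdeal_iff] at hk'
  rw [Set.range_comp, Module.Basis.mem_span_image] at hp
  by_contra hne
  obtain ⟨e, he⟩ := (support_nonempty (p := p)).2 hne
  obtain ⟨⟨e', h'⟩, rfl⟩ := hp he
  exact hk' _ he h'

theorem mcl_span (K : Type*) [Field K] {V : Type*} (G : SimpleGraph V) :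
    ⊤ ≤ Submodule.span K
      (Set.range (fun e : {e : V →₀ ℕ // Indep G e.support} => mcl K G e.1)) := by
  rintro x -
  obtain ⟨p, rfl⟩ := Ideal.Quotient.mk_surjective x
  rw [p.as_sum, map_sum]
  refine Submodule.sum_mem _ fun e _ => ?_
  have : Ideal.Quotient.mk (edgeIdeal K G) (monomial e (coeff e p)) = coeff e p • mcl K G e := by
    rw [mcl, ← Ideal.Quotient.mkₐ_eq_mk K, ← map_smul, smul_monomial, smul_eq_mul, mul_one]
  rw [this]
  refine Submodule.smul_mem _ _ ?_
  by_cases h : Indep G e.support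
  · exact Submodule.subset_span ⟨⟨e, h⟩, rfl⟩
  · rw [(mcl_eq_zero_iff K G e).2 h]; exact Submodule.zero_mem _

/-- Upper bound from a maximal independent set. -/
theorem stanley_le {K : Type*} [Field K] {V : Type*} (G : SimpleGraph V)
    (D : StanleyDecomposition (edgeIdeal K G)) (A : Finset V) (hA : Indep G A)
    (hmax : ∀ v, v ∉ A → ∃ w ∈ A, G.Adj v w) : ∃ j, (D.Z j).card ≤ A.card := by
  classical
  have hind : ∀ j (a : V →₀ ℕ), a.support ⊆ D.Z j → Indep G (D.u j + a).support := by
    intro j a ha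
    by_contra h
    exact (D.free j).ne_zero ⟨a, ha⟩ ((mcl_eq_zero_iff K G _).2 h)
  set eA : V →₀ ℕ := Finsupp.indicator A (fun _ _ => 1) with heA
  have hsA : eA.support = A := by
    ext x; simp [heA, Finsupp.indicator_apply]
  let S : Set {e : V →₀ ℕ // Indep G e.support} :=
    {e | ∃ j, ∃ a : V →₀ ℕ, a.support ⊆ D.Z j ∧ e.1 = D.u j + a}
  have htop : (⊤ : Submodule K (MvPolynomial V K ⧸ edgeIdeal K G)) ≤
      Submodule.span K ((fun e : {e : V →₀ ℕ // Indep G e.support} => mcl K G e.1) '' S) := by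
    rw [← D.internal.submodule_iSup_eq_top]
    refine iSup_le fun j => Submodule.span_le.2 ?_
    rintro _ ⟨a, ha, rfl⟩
    exact Submodule.subset_span ⟨⟨_, hind j a ha⟩, ⟨j, a, ha, rfl⟩, rfl⟩
  have hmem : (⟨eA, hsA.symm ▸ hA⟩ : {e : V →₀ ℕ // Indep G e.support}) ∈ S := by
    by_contra h
    exact (mcl_linearIndependent K G).notMem_span_image h (htop Submodule.mem_top)
  obtain ⟨j, a, ha, he⟩ := hmem
  refine ⟨j, Finset.card_le_card ?_⟩
  have hb := hind j (Finsupp.indicator (D.Z j) (fun _ _ => 1)) (Finsupp.support_indicator_subset _ _)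
  have hsup : ∀ x, x ∈ (D.u j + Finsupp.indicator (D.Z j) (fun _ _ => 1)).support ↔
      D.u j x ≠ 0 ∨ x ∈ D.Z j := by
    intro x
    rw [Finsupp.mem_support_iff, Finsupp.add_apply, Finsupp.indicator_apply]
    split_ifs with h <;> simp [h]
  have hAsub : ∀ x ∈ A, x ∈ (D.u j + Finsupp.indicator (D.Z j) (fun _ _ => 1)).support := by
    intro x hx
    rw [hsup]
    by_contra hcon
    push Not at hcon
    have h1 : eA x = 0 := by
      have : a x = 0 := by
        by_contra h
        exact hcon.2 (ha (Finsupp.mem_support_iff.2 h))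
      simp only at he
      rw [he, Finsupp.add_apply, hcon.1, this]
    rw [← hsA, Finsupp.mem_support_iff] at hx
    exact hx h1
  intro x hx
  by_contra hxA
  obtain ⟨w, hw, hadj⟩ := hmax x hxA
  exact hb x ((hsup x).2 (Or.inr hx)) w (hAsub w hw) hadj

theorem exists_stanley {K : Type*} [Field K] {V : Type*} [Fintype V] (G : SimpleGraph V) (d : ℕ)
    (h : HasPart G Finset.univ d) :
    ∃ D : StanleyDecomposition (edgeIdeal K G), ∀ j, d ≤ (D.Z j).card := by
  classical
  obtain ⟨ι, _, A', B', p1', p2', p3'⟩ := h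
  obtain ⟨m, ⟨eq⟩⟩ := Finite.exists_equiv_fin ι
  obtain ⟨A, B, p1, p2, p3⟩ : ∃ A B : Fin m → Finset V,
      (∀ i, A i ⊆ B i ∧ B i ⊆ Finset.univ ∧ Indep G (B i) ∧ d ≤ (B i).card) ∧
      (∀ s : Finset V, s ⊆ Finset.univ → Indep G s → ∃ i, A i ⊆ s ∧ s ⊆ B i) ∧
      (∀ (s : Finset V) i j, A i ⊆ s → s ⊆ B i → A j ⊆ s → s ⊆ B j → i = j) := by
    refine ⟨A' ∘ eq.symm, B' ∘ eq.symm, fun i => p1' _, ?_, ?_⟩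
    · intro s hs hi
      obtain ⟨i, hi⟩ := p2' s hs hi
      exact ⟨eq i, by simpa using hi⟩
    · intro s i j h1 h2 h3 h4
      exact eq.symm.injective (p3' s _ _ h1 h2 h3 h4)
  let u : Fin m → (V →₀ ℕ) := fun j => Finsupp.indicator (A j) (fun _ _ => 1)
  have hu : ∀ j x, u j x = if x ∈ A j then 1 else 0 := by
    intro j x; simp only [u, Finsupp.indicator_apply]; split_ifs <;> rfl
  have hsupp : ∀ j (a : V →₀ ℕ), a.support ⊆ B j →
      A j ⊆ (u j + a).support ∧ (u j + a).support ⊆ B j := by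
    intro j a ha
    constructor
    · intro x hx
      rw [Finsupp.mem_support_iff, Finsupp.add_apply, hu, if_pos hx]; omega
    · intro x hx
      rw [Finsupp.mem_support_iff, Finsupp.add_apply, hu] at hx
      by_cases h : x ∈ A j
      · exact (p1 j).1 h
      · rw [if_neg h, zero_add] at hx
        exact ha (Finsupp.mem_support_iff.2 hx)
  have hdec : ∀ j (e : V →₀ ℕ), A j ⊆ e.support → e.support ⊆ B j →
      ∃ a : V →₀ ℕ, a.support ⊆ B j ∧ e = u j + a := by
    intro j e h1 h2
    have hle : u j ≤ e := by
      intro x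
      rw [hu]
      split_ifs with h
      · have := Finsupp.mem_support_iff.1 (h1 h); omega
      · omega
    refine ⟨e - u j, ?_, (add_tsub_cancel_of_le hle).symm⟩
    intro x hx
    apply h2
    rw [Finsupp.mem_support_iff, Finsupp.tsub_apply] at hx
    rw [Finsupp.mem_support_iff]; omega
  have hind : ∀ j (a : V →₀ ℕ), a.support ⊆ B j → Indep G (u j + a).support := fun j a ha =>
    (p1 j).2.2.1.subset (hsupp j a ha).2
  have hspan : ∀ j, stanleySpace (edgeIdeal K G) (u j) (B j) =
      Submodule.span K ((fun e : {e : V →₀ ℕ // Indep G e.support} => mcl K G e.1) ''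
        {e | A j ⊆ e.1.support ∧ e.1.support ⊆ B j}) := by
    intro j
    rw [stanleySpace]
    congr 1
    ext x
    constructor
    · rintro ⟨a, ha, rfl⟩
      exact ⟨⟨_, hind j a ha⟩, hsupp j a ha, rfl⟩
    · rintro ⟨⟨e, he⟩, ⟨h1, h2⟩, rfl⟩
      obtain ⟨a, ha, hea⟩ := hdec j e h1 h2
      exact ⟨a, ha, by rw [← hea]; rfl⟩
  refine ⟨⟨m, u, B, ?_, ?_⟩, fun j => (p1 j).2.2.2⟩
  · intro j
    refine (mcl_linearIndependent K G).comp
      (fun a : {a : V →₀ ℕ // a.support ⊆ B j} => ⟨u j + a.1, hind j a.1 a.2⟩) ?_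
    intro a b hab
    have := congrArg Subtype.val hab
    exact Subtype.ext (add_left_cancel this)
  · rw [DirectSum.isInternal_submodule_iff_iSupIndep_and_iSup_eq_top]
    simp_rw [hspan]
    constructor
    · intro i
      simp_rw [← Submodule.span_iUnion, ← Set.image_iUnion]
      refine (mcl_linearIndependent K G).disjoint_span_image ?_
      rw [Set.disjoint_left]
      rintro e ⟨h1, h2⟩ he
      simp only [Set.mem_iUnion] at he
      obtain ⟨j, hj, h3, h4⟩ := he
      exact hj (p3 _ j i h3 h4 h1 h2)
    · rw [← Submodule.span_iUnion, ← Set.image_iUnion, eq_top_iff]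
      refine (mcl_span K G).trans (Submodule.span_mono ?_)
      rintro _ ⟨e, rfl⟩
      obtain ⟨j, hj⟩ := p2 e.1.support (Finset.subset_univ _) e.2
      exact ⟨e, Set.mem_iUnion.2 ⟨j, hj⟩, rfl⟩

theorem sdepth_bounds {K : Type*} [Field K] {V : Type} [Fintype V] [DecidableEq V]
    (G : SimpleGraph V) (A : Finset V) (hA : Indep G A)
    (hmax : ∀ v, v ∉ A → ∃ w ∈ A, G.Adj v w) (d : ℕ) (h : Good G Finset.univ d) :
    d ≤ sdepthQuot (edgeIdeal K G) ∧ sdepthQuot (edgeIdeal K G) ≤ A.card := by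
  have hub : ∀ n ∈ {n : ℕ | ∃ D : StanleyDecomposition (edgeIdeal K G), ∀ j, n ≤ (D.Z j).card},
      n ≤ A.card := by
    rintro n ⟨D, hD⟩
    obtain ⟨j, hj⟩ := stanley_le G D A hA hmax
    exact (hD j).trans hj
  have hmem := exists_stanley (K := K) G d h.hasPart
  exact ⟨le_csSup ⟨A.card, hub⟩ hmem, csSup_le ⟨d, hmem⟩ hub⟩

/-! ### The circulant graph -/

theorem circ_adj (n : ℕ) (hn : 2 ≤ n) (i j : Fin (2 * n)) :
    (circulantGraph (2 * n) ({1, n} : Set ℕ)).Adj i j ↔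
      (i.1 + 1 = j.1 ∨ j.1 + 1 = i.1 ∨ i.1 + n = j.1 ∨ j.1 + n = i.1 ∨
        i.1 + 2 * n = j.1 + 1 ∨ j.1 + 2 * n = i.1 + 1) := by
  rw [circulantGraph, SimpleGraph.fromRel_adj]
  simp only [Set.mem_insert_iff, Set.mem_singleton_iff, ne_eq, Fin.ext_iff]
  have := i.2
  have := j.2
  omega

/-- ladder vertex to circulant vertex -/
def emb (n : ℕ) (hn : 2 ≤ n) (f : ℕ → ℕ) (a : ℕ × Bool) : Fin (2 * n) :=
  ⟨if f a.1 + (if a.2 then n else 0) < 2 * n then f a.1 + (if a.2 then n else 0) else 0,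
    by split_ifs <;> omega⟩

theorem good_D (n : ℕ) (hn : 3 ≤ n) (W : Finset (Fin (2 * n)))
    (hW : ∀ w, w ∈ W ↔ w.1 ≠ 0 ∧ w.1 ≠ 1 ∧ w.1 ≠ n ∧ w.1 + 1 ≠ 2 * n) :
    Good (circulantGraph (2 * n) ({1, n} : Set ℕ)) W (2 * ((n - 3) / 4) + 2) := by
  have h := ((lad_all (n - 3) false).2.2).transfer
    (G := circulantGraph (2 * n) ({1, n} : Set ℕ)) (emb n (by omega) (fun c => c + 1)) ?_ ?_
  · convert h using 1
    ext w
    rw [hW, Finset.mem_image]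
    constructor
    · intro hw
      have := w.2
      by_cases hlt : w.1 < n
      · refine ⟨(w.1 - 1, false), mem_lad.2 ?_, ?_⟩
        · simp; omega
        · simp only [emb, Fin.ext_iff]; simp; split_ifs <;> omega
      · refine ⟨(w.1 - n - 1, true), mem_lad.2 ?_, ?_⟩
        · simp; omega
        · simp only [emb, Fin.ext_iff]; simp; split_ifs <;> omega
    · rintro ⟨⟨c, t⟩, hm, rfl⟩
      rw [mem_lad] at hm
      cases t <;> simp [emb] at * <;> split_ifs <;> omega
  · rintro ⟨c, t⟩ h ⟨c', t'⟩ h'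
    rw [mem_lad] at h h'
    cases t <;> cases t' <;> simp [emb] at * <;> split_ifs <;> omega
  · rintro ⟨c, t⟩ h ⟨c', t'⟩ h'
    rw [mem_lad] at h h'
    rw [circ_adj _ (by omega)]
    cases t <;> cases t' <;> simp [emb, ladder] at * <;> split_ifs <;> omega

theorem good_C (n : ℕ) (hn : 2 ≤ n) (W : Finset (Fin (2 * n)))
    (hW : ∀ w, w ∈ W ↔ w.1 ≠ 0 ∧ w.1 ≠ n + 1) :
    Good (circulantGraph (2 * n) ({1, n} : Set ℕ)) W (2 * (n / 4) + 1) := by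
  have h := ((lad_all (n - 2) false).2.1).transfer
    (G := circulantGraph (2 * n) ({1, n} : Set ℕ)) (emb n (by omega) (fun c => c + 1)) ?_ ?_
  · rw [show n - 2 + 2 = n by omega] at h
    convert h using 1
    ext w
    rw [hW, Finset.mem_image]
    constructor
    · intro hw
      have := w.2
      by_cases hlt : w.1 ≤ n
      · refine ⟨(w.1 - 1, false), mem_lad.2 ?_, ?_⟩
        · simp; omega
        · simp only [emb, Fin.ext_iff]; simp; split_ifs <;> omega
      · refine ⟨(w.1 - n - 1, true), mem_lad.2 ?_, ?_⟩
        · simp; omega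
        · simp only [emb, Fin.ext_iff]; simp; split_ifs <;> omega
    · rintro ⟨⟨c, t⟩, hm, rfl⟩
      rw [mem_lad] at hm
      cases t <;> simp [emb] at * <;> split_ifs <;> omega
  · rintro ⟨c, t⟩ h ⟨c', t'⟩ h'
    rw [mem_lad] at h h'
    cases t <;> cases t' <;> simp [emb] at * <;> split_ifs <;> omega
  · rintro ⟨c, t⟩ h ⟨c', t'⟩ h'
    rw [mem_lad] at h h'
    rw [circ_adj _ (by omega)]
    cases t <;> cases t' <;> simp [emb, ladder] at * <;> split_ifs <;> omega

theorem good_B (n : ℕ) (hn : 3 ≤ n) (W : Finset (Fin (2 * n)))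
    (hW : ∀ w, w ∈ W ↔ w.1 ≠ 0 ∧ w.1 ≠ n + 1 ∧ w.1 ≠ n ∧ w.1 ≠ 1 ∧ w.1 ≠ n + 2) :
    Good (circulantGraph (2 * n) ({1, n} : Set ℕ)) W ((n - 3) / 2 + 1) := by
  have h := ((lad_all (n - 3) false).1).transfer
    (G := circulantGraph (2 * n) ({1, n} : Set ℕ)) (emb n (by omega) (fun c => n - c)) ?_ ?_
  · convert h using 1
    ext w
    rw [hW, Finset.mem_image]
    constructor
    · intro hw
      have := w.2
      by_cases hlt : w.1 < n
      · refine ⟨(n - w.1, false), mem_lad.2 ?_, ?_⟩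
        · simp; omega
        · simp only [emb, Fin.ext_iff]; simp; split_ifs <;> omega
      · refine ⟨(2 * n - w.1, true), mem_lad.2 ?_, ?_⟩
        · simp; omega
        · simp only [emb, Fin.ext_iff]; simp; split_ifs <;> omega
    · rintro ⟨⟨c, t⟩, hm, rfl⟩
      rw [mem_lad] at hm
      cases t <;> simp [emb] at * <;> split_ifs <;> omega
  · rintro ⟨c, t⟩ h ⟨c', t'⟩ h'
    rw [mem_lad] at h h'
    cases t <;> cases t' <;> simp [emb] at * <;> split_ifs <;> omega
  · rintro ⟨c, t⟩ h ⟨c', t'⟩ h'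
    rw [mem_lad] at h h'
    rw [circ_adj _ (by omega)]
    cases t <;> cases t' <;> simp [emb, ladder] at * <;> split_ifs <;> omega

theorem good_circ (n : ℕ) (hn : 2 ≤ n) (d : ℕ)
    (hd : d + 1 = if n % 4 = 1 then (n + 1) / 2 else n / 2) :
    Good (circulantGraph (2 * n) ({1, n} : Set ℕ)) Finset.univ (d + 1) := by
  refine .split _ (Finset.univ.filter (fun w => w.1 ≠ 0))
    (Finset.univ.filter (fun w => w.1 ≠ 0 ∧ w.1 ≠ 1 ∧ w.1 ≠ n ∧ w.1 + 1 ≠ 2 * n)) d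
    ⟨0, by omega⟩ (Finset.mem_univ _) ?_ ?_ ?_ ?_
  · intro w; simp [Fin.ext_iff]
  · intro w
    have := w.2
    rw [circ_adj n hn]
    simp [Fin.ext_iff]; omega
  · refine .split _ (Finset.univ.filter (fun w => w.1 ≠ 0 ∧ w.1 ≠ n + 1))
      (Finset.univ.filter (fun w => w.1 ≠ 0 ∧ w.1 ≠ n + 1 ∧ w.1 ≠ n ∧ w.1 ≠ 1 ∧ w.1 ≠ n + 2)) d
      ⟨n + 1, by omega⟩ ?_ ?_ ?_ ?_ ?_
    · simp
    · intro w; simp [Fin.ext_iff]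
    · intro w
      have := w.2
      rw [circ_adj n hn]
      simp [Fin.ext_iff]; omega
    · exact (good_C n hn _ (by simp)).mono _ (by split_ifs at hd <;> omega)
    · rcases Nat.lt_or_ge n 3 with h | h
      · obtain rfl : n = 2 := by omega
        obtain rfl : d = 0 := by simpa using hd
        exact .zero _
      · exact (good_B n h _ (by simp)).mono _ (by split_ifs at hd <;> omega)
  · rcases Nat.lt_or_ge n 3 with h | h
    · obtain rfl : n = 2 := by omega
      obtain rfl : d = 0 := by simpa using hd
      exact .zero _
    · exact (good_D n h _ (by simp)).mono _ (by split_ifs at hd <;> omega)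

/-- The small maximal independent set. -/
def smallPred (n v : ℕ) : Prop :=
  (v < n ∧ v % 4 = 0) ∨ (n ≤ v ∧ (v - n) % 4 = 2 ∧ ¬ (n % 4 = 3 ∧ v + 1 = 2 * n)) ∨
    (n % 4 = 0 ∧ v + 1 = n) ∨ (n % 4 = 3 ∧ (v + 1 = n ∨ v + 2 = 2 * n))

instance (n v : ℕ) : Decidable (smallPred n v) := by unfold smallPred; infer_instance

theorem small_dom (n v : ℕ) (hn : 2 ≤ n) (hv : v < 2 * n) : smallPred n v ∨
    (v + 1 < 2 * n ∧ smallPred n (v + 1)) ∨ (1 ≤ v ∧ smallPred n (v - 1)) ∨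
    (v < n ∧ smallPred n (v + n)) ∨ (n ≤ v ∧ smallPred n (v - n)) ∨
    (v + 1 = 2 * n ∧ smallPred n 0) := by
  simp only [smallPred]
  obtain ⟨k, hk⟩ : ∃ k, n = 4 * k ∨ n = 4 * k + 1 ∨ n = 4 * k + 2 ∨ n = 4 * k + 3 :=
    ⟨n / 4, by omega⟩
  rcases Nat.lt_or_ge v n with hl | hl
  · obtain ⟨q, hq⟩ : ∃ q, v = 4 * q ∨ v = 4 * q + 1 ∨ v = 4 * q + 2 ∨ v = 4 * q + 3 :=
      ⟨v / 4, by omega⟩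
    rcases hk with rfl | rfl | rfl | rfl <;> rcases hq with rfl | rfl | rfl | rfl <;> grind
  · obtain ⟨c, rfl⟩ := Nat.exists_eq_add_of_le hl
    obtain ⟨q, hq⟩ : ∃ q, c = 4 * q ∨ c = 4 * q + 1 ∨ c = 4 * q + 2 ∨ c = 4 * q + 3 :=
      ⟨c / 4, by omega⟩
    rcases hk with rfl | rfl | rfl | rfl <;> rcases hq with rfl | rfl | rfl | rfl <;> grind

theorem small_indep (n a b : ℕ) (hn : 2 ≤ n) (ha' : a < 2 * n) (hb' : b < 2 * n)
    (ha : smallPred n a) (hb : smallPred n b) :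
    a + 1 ≠ b ∧ a + n ≠ b ∧ a + 2 * n ≠ b + 1 := by
  simp only [smallPred] at ha hb
  obtain ⟨k, hk⟩ : ∃ k, n = 4 * k ∨ n = 4 * k + 1 ∨ n = 4 * k + 2 ∨ n = 4 * k + 3 :=
    ⟨n / 4, by omega⟩
  refine ⟨?_, ?_, ?_⟩ <;> rintro h
  · subst h
    rcases hk with rfl | rfl | rfl | rfl <;> omega
  · subst h
    rcases hk with rfl | rfl | rfl | rfl <;> omega
  · obtain rfl : a = 0 := by omega
    obtain rfl : b = 2 * n - 1 := by omega
    rcases hk with rfl | rfl | rfl | rfl <;> omega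

/-- enumeration of the small maximal independent set -/
def smallEnum (n i : ℕ) : ℕ :=
  if n % 4 = 0 ∧ 2 * i = n then n - 1
  else if n % 4 = 3 ∧ 2 * i + 1 = n then n - 1
  else if n % 4 = 3 ∧ 2 * i = n + 1 then 2 * n - 2
  else if i % 2 = 0 then 2 * i else n + 2 * i

theorem small_enum (n v : ℕ) (hv : v < 2 * n) (h : smallPred n v) :
    ∃ i, i < (if n % 4 = 1 ∨ n % 4 = 2 then (n + 1) / 2 else (n + 1) / 2 + 1) ∧
      smallEnum n i = v := by
  rcases h with ⟨h1, h2⟩ | ⟨h1, h2, h3⟩ | ⟨h1, h2⟩ | ⟨h1, h2 | h2⟩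
  · refine ⟨v / 2, ?_, ?_⟩
    · split_ifs <;> omega
    · rw [smallEnum, if_neg (by omega), if_neg (by omega), if_neg (by omega), if_pos (by omega)]
      omega
  · obtain ⟨c, rfl⟩ := Nat.exists_eq_add_of_le h1
    rw [Nat.add_sub_cancel_left] at h2
    refine ⟨c / 2, ?_, ?_⟩
    · split_ifs <;> omega
    · rw [smallEnum, if_neg (by omega), if_neg (by omega), if_neg (by omega), if_neg (by omega)]
      omega
  · refine ⟨n / 2, ?_, ?_⟩
    · split_ifs <;> omega
    · rw [smallEnum, if_pos (by omega)]; omega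
  · refine ⟨n / 2, ?_, ?_⟩
    · split_ifs <;> omega
    · rw [smallEnum, if_neg (by omega), if_pos (by omega)]; omega
  · refine ⟨(n + 1) / 2, ?_, ?_⟩
    · split_ifs <;> omega
    · rw [smallEnum, if_neg (by omega), if_neg (by omega), if_pos (by omega)]; omega

theorem small_exists (n : ℕ) (hn : 2 ≤ n) : ∃ A : Finset (Fin (2 * n)),
    Indep (circulantGraph (2 * n) ({1, n} : Set ℕ)) A ∧
    (∀ v, v ∉ A → ∃ w ∈ A, (circulantGraph (2 * n) ({1, n} : Set ℕ)).Adj v w) ∧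
    A.card ≤ (if n % 4 = 1 ∨ n % 4 = 2 then (n + 1) / 2 else (n + 1) / 2 + 1) := by
  refine ⟨Finset.univ.filter (fun v => smallPred n v.1), ?_, ?_, ?_⟩
  · intro a ha b hb
    simp only [Finset.mem_filter, Finset.mem_univ, true_and] at ha hb
    rw [circ_adj n hn]
    have h1 := small_indep n a.1 b.1 hn a.2 b.2 ha hb
    have h2 := small_indep n b.1 a.1 hn b.2 a.2 hb ha
    clear ha hb
    omega
  · intro v hv
    have hvl := v.2
    have key : ∃ w, ∃ hw : w < 2 * n, smallPred n w ∧
      (v.1 + 1 = w ∨ w + 1 = v.1 ∨ v.1 + n = w ∨ w + n = v.1 ∨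
        v.1 + 2 * n = w + 1 ∨ w + 2 * n = v.1 + 1) := by
      simp only [Finset.mem_filter, Finset.mem_univ, true_and] at hv
      rcases small_dom n v.1 hn hvl with h | ⟨h, h'⟩ | ⟨h, h'⟩ | ⟨h, h'⟩ | ⟨h, h'⟩ | ⟨h, h'⟩
      · exact absurd h hv
      all_goals exact ⟨_, by omega, h', by omega⟩
    obtain ⟨w, hw, hs, hadj⟩ := key
    exact ⟨⟨w, hw⟩, by simpa using hs, (circ_adj n hn _ _).2 hadj⟩
  · set t := (if n % 4 = 1 ∨ n % 4 = 2 then (n + 1) / 2 else (n + 1) / 2 + 1) with ht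
    rw [← Finset.card_image_of_injective _ Fin.val_injective, ← Finset.card_range t]
    refine le_trans (Finset.card_le_card (t := (Finset.range t).image (smallEnum n)) ?_)
      Finset.card_image_le
    intro x hx
    obtain ⟨v, hv, rfl⟩ := Finset.mem_image.1 hx
    obtain ⟨i, hi, he⟩ := small_enum n v.1 v.2 (Finset.mem_filter.1 hv).2
    exact Finset.mem_image.2 ⟨i, Finset.mem_range.2 hi, he⟩

theorem ceil_half (n : ℕ) : ⌈(n : ℚ) / 2⌉₊ = (n + 1) / 2 := by
  apply le_antisymm
  · rw [Nat.ceil_le, div_le_iff₀ (by norm_num)]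
    have : n ≤ (n + 1) / 2 * 2 := by omega
    exact_mod_cast this
  · have h := Nat.le_ceil ((n : ℚ) / 2)
    rw [div_le_iff₀ (by norm_num)] at h
    have h' : n ≤ ⌈(n : ℚ) / 2⌉₊ * 2 := by exact_mod_cast h
    omega

theorem ceil_half_pred (n : ℕ) (hn : 1 ≤ n) : ⌈((n : ℚ) - 1) / 2⌉₊ = n / 2 := by
  have h := ceil_half (n - 1)
  rw [Nat.cast_sub hn, Nat.cast_one, Nat.sub_add_cancel hn] at h
  exact h

theorem sdepth_circulant_one (n : ℕ) (hn : 2 ≤ n) (K : Type*) [Field K] :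
    (n % 4 = 1 → sdepthQuot (edgeIdeal K (circulantGraph (2 * n) ({1, n} : Set ℕ))) = ⌈(n : ℚ) / 2⌉₊) ∧
    (n % 4 = 2 → sdepthQuot (edgeIdeal K (circulantGraph (2 * n) ({1, n} : Set ℕ))) = ⌈((n : ℚ) - 1) / 2⌉₊) ∧
    ((n % 4 = 0 ∨ n % 4 = 3) →
      ⌈((n : ℚ) - 1) / 2⌉₊ ≤ sdepthQuot (edgeIdeal K (circulantGraph (2 * n) ({1, n} : Set ℕ))) ∧
      sdepthQuot (edgeIdeal K (circulantGraph (2 * n) ({1, n} : Set ℕ))) ≤ ⌈(n : ℚ) / 2⌉₊ + 1) := by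
  obtain ⟨A, hA, hmax, hcard⟩ := small_exists n hn
  have hpos : 1 ≤ if n % 4 = 1 then (n + 1) / 2 else n / 2 := by split_ifs <;> omega
  have hg := good_circ n hn ((if n % 4 = 1 then (n + 1) / 2 else n / 2) - 1) (by omega)
  rw [Nat.sub_add_cancel hpos] at hg
  obtain ⟨h1, h2⟩ := sdepth_bounds (K := K) _ A hA hmax _ hg
  rw [ceil_half, ceil_half_pred n (by omega)]
  have h3 := h2.trans hcard
  generalize sdepthQuot (edgeIdeal K (circulantGraph (2 * n) ({1, n} : Set ℕ))) = s at *
  clear h2 hg hpos hcard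
  split_ifs at h1 h3 <;> omega
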